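/- Fix integers k ≥ 1, 0 ≤ l ≤ k and m = (m₁, …, m_k) ∈ ℤ_{≥0}^k such that |m| − l is a nonnegative even integer, and set s = (|m| − l)/2. Then the space 𝓕 of symmetric polynomials is finite dimensional, and dim_ℂ 𝓕 ≤ ∑_{𝐬} ∏_{a=1}^k C(P_a(𝐬), s_a), where the sum runs over all 𝐬 = (s₁, …, s_k) ∈ ℤ_{≥0}^k with 2∑_{a=1}^k a·s_a = |m| − l, where P_a(𝐬) = ∑_{b=1}^k min(a,b)·(m_b − 2 s_b) − max(a − k + l, 0) + s_a ∈ ℤ, and where C(P, n) denotes the binomial coefficient 'P choose n' if 0 ≤ n ≤ P and is 0 otherwise (in particular 0 whenever P < n or P < 0 with n > 0). -/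

import Mathlib

noncomputable section

/-- `|m| = ∑ i·mᵢ` (indices `1, …, k`). -/
def wt (k : ℕ) (m : Fin k → ℕ) : ℕ := ∑ i, (i.1 + 1) * m i

/-- `M_a = ∑ min(a,i)·mᵢ`. -/
def Ma (k : ℕ) (m : Fin k → ℕ) (a : ℕ) : ℕ := ∑ i, min a (i.1 + 1) * m i

/-- The specialization `f(x, …, x, x_{a+1}, …, x_s)` (the first `a` variables set
equal to a single new variable `x`), as a polynomial in `x` with coefficients
that are polynomials in the remaining variables. -/
def spec (s a : ℕ) (f : MvPolynomial (Fin s) ℂ) :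
    Polynomial (MvPolynomial (Fin s) ℂ) :=
  MvPolynomial.aeval (fun i : Fin s =>
    if (i : ℕ) < a then (Polynomial.X : Polynomial (MvPolynomial (Fin s) ℂ))
    else Polynomial.C (MvPolynomial.X i)) f

/-- The substitution setting the first `c` variables to `0`. -/
def zeroFirst (s c : ℕ) (f : MvPolynomial (Fin s) ℂ) : MvPolynomial (Fin s) ℂ :=
  MvPolynomial.aeval (fun i : Fin s =>
    if (i : ℕ) < c then 0 else MvPolynomial.X i) f

/-- The space `𝓕` of symmetric polynomials in `s` variables satisfying:
(1) `deg_x f(x,…,x,x_{a+1},…,x_s) ≤ M_a - a` for `1 ≤ a ≤ s`;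
(2) `f(0, x₂, …, x_s) = 0`;
(3) if `s ≥ k - l + 1` then, writing `f = (∏ xᵢ)·g`, the polynomial `g`
vanishes when its first `k - l + 1` variables are set to `0`. -/
def FSpace (k l s : ℕ) (m : Fin k → ℕ) : Set (MvPolynomial (Fin s) ℂ) :=
  {f | f.IsSymmetric ∧
    (∀ a : ℕ, 1 ≤ a → a ≤ s → ∀ d : ℕ,
      (Ma k m a : ℤ) - (a : ℤ) < (d : ℤ) → (spec s a f).coeff d = 0) ∧
    zeroFirst s 1 f = 0 ∧
    (k - l + 1 ≤ s → ∀ gg : MvPolynomial (Fin s) ℂ,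
      f = (∏ i, MvPolynomial.X i) * gg → zeroFirst s (k - l + 1) gg = 0)}

/-- `C(P, n)`: the binomial coefficient `P choose n` when `0 ≤ n ≤ P`
(for `P : ℤ`), and `0` otherwise. -/
def czChoose (P : ℤ) (n : ℕ) : ℕ := if 0 ≤ P then P.toNat.choose n else 0

/-- The entry `P_a(𝐬) = ∑_b min(a,b)(m_b - 2s_b) - max(a-k+l, 0) + s_a`. -/
def Pent (k l : ℕ) (m : Fin k → ℕ) (v : Fin k → ℕ) (a : Fin k) : ℤ :=
  (∑ b : Fin k, (min (a.1 + 1) (b.1 + 1) : ℤ) * ((m b : ℤ) - 2 * (v b : ℤ)))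
    - max ((a.1 + 1 : ℤ) - (k : ℤ) + (l : ℤ)) 0 + (v a : ℤ)

namespace FB

open MvPolynomial Finset

/-- fibre size -/
def fib {s : ℕ} {T : Type} (p : Fin s → T) (t : T) : ℕ := by
  classical exact (univ.filter fun i => p i = t).card

/-- weight of a specialization -/
def W {s : ℕ} {T : Type} (p : Fin s → T) : ℕ := ∑ i, (s + 2) ^ fib p (p i)

theorem fib_eq {s : ℕ} {T : Type} [DecidableEq T] (p : Fin s → T) (t : T) :
    fib p t = (univ.filter fun i => p i = t).card := by
  unfold fib
  congr

theorem fib_le {s : ℕ} {T : Type} (p : Fin s → T) (t : T) : fib p t ≤ s := by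
  classical
  rw [fib_eq]
  exact (card_le_univ _).trans (by simp)

theorem fib_pos {s : ℕ} {T : Type} (p : Fin s → T) (i : Fin s) : 0 < fib p (p i) := by
  classical
  rw [fib_eq]
  exact card_pos.2 ⟨i, by simp⟩

theorem exists_of_fib {s : ℕ} {T : Type} (p : Fin s → T) (t : T) (h : 0 < fib p t) :
    ∃ i, p i = t := by
  classical
  rw [fib_eq] at h
  obtain ⟨i, hi⟩ := card_pos.1 h
  exact ⟨i, by simpa using hi⟩

theorem sum_fib {s : ℕ} {T : Type} [Fintype T] (p : Fin s → T) : ∑ t, fib p t = s := by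
  classical
  have := card_eq_sum_card_fiberwise (f := p) (s := univ) (t := univ) (by simp)
  simp only [card_univ, Fintype.card_fin] at this
  simp only [fib_eq]
  exact this.symm

theorem exists_perm {s : ℕ} {T : Type} (p q : Fin s → T) (h : ∀ t, fib p t = fib q t) :
    ∃ σ : Equiv.Perm (Fin s), ∀ i, q (σ i) = p i := by
  classical
  have : ∀ t, Nonempty ({ a // p a = t } ≃ { b // q b = t }) := by
    intro t
    refine ⟨Fintype.equivOfCardEq ?_⟩
    have := h t
    rw [fib_eq, fib_eq] at this
    rw [Fintype.card_subtype, Fintype.card_subtype, this]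
  exact ⟨Equiv.ofFiberEquiv fun t => (this t).some, fun i => Equiv.ofFiberEquiv_map _ i⟩

theorem fib_comp_inj {s : ℕ} {T T' : Type} (p : Fin s → T) (g : T → T')
    (hg : Function.Injective g) (t : T) : fib (g ∘ p) (g t) = fib p t := by
  classical
  rw [fib_eq, fib_eq]
  simp [hg.eq_iff]

theorem fib_comp_perm {s : ℕ} {T : Type} (p : Fin s → T) (σ : Equiv.Perm (Fin s)) (t : T) :
    fib (p ∘ σ) t = fib p t := by
  classical
  rw [fib_eq, fib_eq]
  refine card_bij (fun i _ => σ i) ?_ ?_ ?_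
  · intro a ha; simpa using ha
  · intro a _ b _ h; exact σ.injective h
  · intro b hb; exact ⟨σ.symm b, by simpa using hb, by simp⟩

theorem W_comp_inj {s : ℕ} {T T' : Type} (p : Fin s → T) (g : T → T')
    (hg : Function.Injective g) : W (g ∘ p) = W p := by
  unfold W
  refine sum_congr rfl fun i _ => ?_
  rw [Function.comp_apply, fib_comp_inj p g hg]

theorem W_comp_perm {s : ℕ} {T : Type} (p : Fin s → T) (σ : Equiv.Perm (Fin s)) :
    W (p ∘ σ) = W p := by
  unfold W
  simp only [fib_comp_perm, Function.comp_apply]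
  exact Equiv.sum_comp σ fun i => (s + 2) ^ fib p (p i)

theorem W_le {s : ℕ} {T : Type} (p : Fin s → T) : W p ≤ s * (s + 2) ^ s := by
  unfold W
  refine (sum_le_card_nsmul _ _ ((s + 2) ^ s) fun i _ => ?_).trans (by simp)
  exact Nat.pow_le_pow_right (by omega) (fib_le _ _)

theorem W_big {s k : ℕ} {T T' : Type} (p : Fin s → T) (q : Fin s → T') (h : W p < W q)
    (t : T) (ht : k < fib p t) : ∃ t', k < fib q t' := by
  by_contra! hc
  have h1 : W q ≤ s * (s + 2) ^ k := by
    unfold W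
    refine (sum_le_card_nsmul _ _ ((s + 2) ^ k) fun i _ => ?_).trans (by simp)
    exact Nat.pow_le_pow_right (by omega) (hc _)
  obtain ⟨i, hi⟩ := exists_of_fib p t (by omega)
  have h2 : (s + 2) ^ (k + 1) ≤ W p := by
    unfold W
    refine le_trans ?_ (single_le_sum (f := fun i => (s + 2) ^ fib p (p i))
      (fun _ _ => Nat.zero_le _) (mem_univ i))
    exact Nat.pow_le_pow_right (by omega) (by rw [hi]; exact ht)
  have h3 : s * (s + 2) ^ k < (s + 2) ^ (k + 1) := by
    rw [pow_succ, mul_comm]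
    exact Nat.mul_lt_mul_of_pos_left (by omega) (by positivity)
  omega

/-- the merged specialization -/
def mrg {s : ℕ} {T : Type} (p : Fin s → T) (t u : T) (i0 : Fin s) : Fin s → T ⊕ Fin s := by
  classical
  exact fun i => if i = i0 then Sum.inl t else if p i = u then Sum.inr i else Sum.inl (p i)

/-- the split specialization -/
def spl {s : ℕ} {T : Type} (p : Fin s → T) (u : T) : Fin s → T ⊕ Fin s := by
  classical
  exact fun i => if p i = u then Sum.inr i else Sum.inl (p i)

theorem W_mrg {s : ℕ} {T : Type} (p : Fin s → T) (t u : T) (htu : t ≠ u) (i0 : Fin s)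
    (hi0 : p i0 = u) (hle : fib p u ≤ fib p t) : W p < W (mrg p t u i0) := by
  classical
  set A := univ.filter fun i => p i = t with hA
  set B := univ.filter fun i => p i = u with hB
  have hAB : Disjoint A B := by
    rw [Finset.disjoint_left]; intro i hi hi'
    simp [A, B] at hi hi'; exact htu (hi ▸ hi')
  have hAi : i0 ∉ A := by simp [A, hi0, Ne.symm htu]
  have hq : ∀ i, mrg p t u i0 i = if i = i0 then Sum.inl t else
    if p i = u then Sum.inr i else Sum.inl (p i) := fun i => by
      unfold mrg; congr
  have hfibt : fib (mrg p t u i0) (Sum.inl t) = fib p t + 1 := by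
    rw [fib_eq, fib_eq, ← hA, ← card_insert_of_notMem hAi]
    congr 1
    ext i
    simp only [hq, mem_filter, mem_univ, true_and, mem_insert, A]
    split_ifs with h1 h2
    · simp [h1]
    · simp [h1, h2, Ne.symm htu]
    · simp [h1]
  have hfibo : ∀ i, i ∉ A ∪ B → fib (mrg p t u i0) (mrg p t u i0 i) = fib p (p i) := by
    intro i hi
    simp only [mem_union, not_or, A, B, mem_filter, mem_univ, true_and] at hi
    have hii : i ≠ i0 := by rintro rfl; exact hi.2 hi0
    rw [hq i, if_neg hii, if_neg hi.2, fib_eq, fib_eq]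
    congr 1
    ext j
    simp only [hq, mem_filter, mem_univ, true_and]
    split_ifs with h1 h2
    · subst h1; simp only [Sum.inl.injEq, hi0]
      exact ⟨fun h => absurd h.symm hi.1, fun h => absurd h.symm hi.2⟩
    · simp [h2, Ne.symm hi.2]
    · simp
  have hWp : W p = ∑ i ∈ univ \ (A ∪ B), (s + 2) ^ fib p (p i) +
      (fib p t * (s + 2) ^ fib p t + fib p u * (s + 2) ^ fib p u) := by
    unfold W
    rw [← sum_sdiff (subset_univ (A ∪ B)), sum_union hAB]
    congr 2
    · rw [sum_congr rfl (g := fun _ => (s + 2) ^ fib p t), sum_const, fib_eq p t, smul_eq_mul]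
      intro i hi; simp [A] at hi; rw [hi]
    · rw [sum_congr rfl (g := fun _ => (s + 2) ^ fib p u), sum_const, fib_eq p u, smul_eq_mul]
      intro i hi; simp [B] at hi; rw [hi]
  have hWq : ∑ i ∈ univ \ (A ∪ B), (s + 2) ^ fib p (p i) +
      (fib p t + 1) * (s + 2) ^ (fib p t + 1) ≤ W (mrg p t u i0) := by
    unfold W
    rw [← sum_sdiff (subset_univ (A ∪ B))]
    refine add_le_add (le_of_eq ?_) ?_
    · refine sum_congr rfl fun i hi => ?_
      rw [hfibo i (by simpa using hi)]
    · have hsub : insert i0 A ⊆ A ∪ B := by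
        intro i hi
        rcases mem_insert.1 hi with rfl | hi
        · exact mem_union_right _ (by simp [B, hi0])
        · exact mem_union_left _ hi
      refine le_trans (le_of_eq ?_) (sum_le_sum_of_subset hsub)
      rw [sum_congr rfl (g := fun _ => (s + 2) ^ (fib p t + 1)), sum_const,
        card_insert_of_notMem hAi, fib_eq p t, smul_eq_mul]
      intro i hi
      have : mrg p t u i0 i = Sum.inl t := by
        rw [hq]
        rcases mem_insert.1 hi with rfl | hi
        · simp
        · simp [A] at hi; simp [hi, htu]
      rw [this, hfibt]
  refine lt_of_lt_of_le ?_ hWq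
  rw [hWp]
  refine Nat.add_lt_add_left ?_ _
  have h1 : fib p u * (s + 2) ^ fib p u ≤ fib p t * (s + 2) ^ fib p t :=
    Nat.mul_le_mul hle (Nat.pow_le_pow_right (by omega) hle)
  have h2 : (fib p t + 1) * (s + 2) ^ (fib p t + 1) =
      (fib p t + 1) * (s + 2) * (s + 2) ^ fib p t := by ring
  have h3 : 0 < (s + 2) ^ fib p t := by positivity
  rw [h2]
  calc _ ≤ 2 * fib p t * (s + 2) ^ fib p t := by linarith
    _ < _ := by
      refine Nat.mul_lt_mul_of_pos_right ?_ h3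
      nlinarith

end FB
namespace FB

open MvPolynomial Finset

/-- replace the variable `v` by `t` -/
def rep {T : Type} (v t : T) : T → T := by
  classical exact fun x => if x = v then t else x

theorem rep_eq {T : Type} [DecidableEq T] (v t x : T) :
    rep v t x = if x = v then t else x := by
  unfold rep; congr

theorem X_sub_X_dvd_iff {T : Type} (v t : T) (F : MvPolynomial T ℂ) :
    X v - X t ∣ F ↔ rename (rep v t) F = 0 := by
  classical
  constructor
  · rintro ⟨G, rfl⟩
    rw [map_mul, map_sub, rename_X, rename_X, rep_eq, rep_eq]
    by_cases h : t = v
    · simp [h]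
    · simp [h]
  · intro h
    rw [← Ideal.mem_span_singleton, ← Ideal.Quotient.eq_zero_iff_mem]
    have : (Ideal.Quotient.mkₐ ℂ (Ideal.span {(X v - X t : MvPolynomial T ℂ)})) =
        (Ideal.Quotient.mkₐ ℂ (Ideal.span {(X v - X t : MvPolynomial T ℂ)})).comp
          (rename (rep v t)) := by
      apply algHom_ext
      intro x
      simp only [AlgHom.comp_apply, rename_X, rep_eq]
      split_ifs with hx
      · subst hx
        simp only [Ideal.Quotient.mkₐ_eq_mk]
        rw [Ideal.Quotient.eq]
        exact Ideal.mem_span_singleton_self _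
      · rfl
    have h2 := congrArg (fun φ => φ F) this
    simp only [AlgHom.comp_apply, h, map_zero] at h2
    exact h2

theorem X_sub_X_ne {T : Type} {v t : T} (h : v ≠ t) : (X v - X t : MvPolynomial T ℂ) ≠ 0 := by
  rw [sub_ne_zero]
  exact fun h' => h (X_injective h')

theorem X_sub_X_prime {T : Type} {v t : T} (h : v ≠ t) :
    Prime (X v - X t : MvPolynomial T ℂ) := by
  refine ⟨X_sub_X_ne h, ?_, ?_⟩
  · intro hu
    have h1 : (X v - X t : MvPolynomial T ℂ) ∣ 1 := hu.dvd
    rw [X_sub_X_dvd_iff] at h1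
    simp at h1
  · intro a b hab
    rw [X_sub_X_dvd_iff] at *
    rw [map_mul] at hab
    rw [X_sub_X_dvd_iff]
    exact mul_eq_zero.1 hab

theorem pderiv_rename' {s : ℕ} {T : Type} [DecidableEq T] (p : Fin s → T) (v : T) (f : MvPolynomial (Fin s) ℂ) :
    pderiv v (rename p f) =
      ∑ i, (if p i = v then 1 else 0 : ℂ) • rename p (pderiv i f) := by
  classical
  induction f using MvPolynomial.induction_on with
  | C a => simp
  | add f g hf hg => simp only [map_add, hf, hg, smul_add, sum_add_distrib]
  | mul_X f j hf =>
    simp only [map_mul, rename_X, pderiv_mul, hf, map_add, smul_add, sum_add_distrib]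
    congr 1
    · rw [sum_mul]; simp only [smul_mul_assoc]
    · simp only [pderiv_X, Pi.single_apply]
      rw [sum_eq_single j]
      · by_cases h : p j = v <;> simp [h]
      · intro i _ hij
        simp [Ne.symm hij]
      · simp

/-- derivative vanishing -/
theorem rename_pderiv_zero {s : ℕ} {T : Type} (q : Fin s → T) (f : MvPolynomial (Fin s) ℂ)
    (hf : f.IsSymmetric) (i0 : Fin s) (h : rename q f = 0) :
    rename q (pderiv i0 f) = 0 := by
  classical
  have h1 := pderiv_rename' q (q i0) f
  rw [h, map_zero] at h1
  have h2 : ∀ i, q i = q i0 → rename q (pderiv i f) = rename q (pderiv i0 f) := by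
    intro i hi
    have h3 : pderiv i f = rename (Equiv.swap i i0) (pderiv i0 f) := by
      have := pderiv_rename (Equiv.swap i i0).injective i0 f
      rwa [hf, Equiv.swap_apply_right] at this
    rw [h3, rename_rename]
    congr 2
    funext j
    simp only [Function.comp_apply, Equiv.swap_apply_def]
    split_ifs with h4 h5
    · rw [h4, hi]
    · rw [h5, hi]
    · rfl
  have h3 : ∑ i, (if q i = q i0 then 1 else 0 : ℂ) • rename q (pderiv i f) =
      (fib q (q i0) : ℂ) • rename q (pderiv i0 f) := by
    rw [fib_eq, card_filter]
    push_cast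
    rw [sum_smul]
    refine sum_congr rfl fun i _ => ?_
    by_cases hi : q i = q i0
    · rw [h2 i hi]
    · simp [hi]
  rw [h3] at h1
  rcases smul_eq_zero.1 h1.symm with h4 | h4
  · have := fib_pos q i0
    rw [Nat.cast_eq_zero] at h4; omega
  · exact h4

theorem sq_dvd {T : Type} (v t : T) (hvt : v ≠ t) (F : MvPolynomial T ℂ)
    (h1 : rename (rep v t) F = 0) (h2 : rename (rep v t) (pderiv v F) = 0) :
    (X v - X t) ^ 2 ∣ F := by
  rw [← X_sub_X_dvd_iff] at h1
  obtain ⟨G, rfl⟩ := h1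
  rw [pow_two]
  refine mul_dvd_mul_left _ ?_
  rw [X_sub_X_dvd_iff]
  rw [pderiv_mul, map_sub, pderiv_X_self, pderiv_X_of_ne (Ne.symm hvt), sub_zero, one_mul,
    map_add, map_mul] at h2
  have : rename (rep v t) (X v - X t : MvPolynomial T ℂ) = 0 := by
    rw [← X_sub_X_dvd_iff]
  rwa [this, zero_mul, add_zero] at h2

theorem relPrime_of_not_dvd {T : Type} {a b c d : T} (hab : a ≠ b)
    (hac : ¬ ((X a - X b : MvPolynomial T ℂ) ∣ (X c - X d))) (m n : ℕ) :
    IsRelPrime ((X a - X b : MvPolynomial T ℂ) ^ m) ((X c - X d) ^ n) := by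
  apply IsRelPrime.pow
  exact (X_sub_X_prime hab).irreducible.isRelPrime_iff_not_dvd.2 hac

theorem split_dvd {s : ℕ} {T : Type} (p : Fin s → T) (t u : T) (htu : t ≠ u)
    (hle : fib p u ≤ fib p t) (f : MvPolynomial (Fin s) ℂ) (hf : f.IsSymmetric)
    (H : ∀ (q : Fin s → T ⊕ Fin s), W p < W q → rename q f = 0) (i0 : Fin s) (hi0 : p i0 = u) :
    (X (Sum.inr i0) - X (Sum.inl t)) ^ 2 ∣ rename (spl p u) f := by
  classical
  have hcomp : rep (Sum.inr i0) (Sum.inl t) ∘ spl p u = mrg p t u i0 := by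
    funext i
    simp only [Function.comp_apply, rep_eq, spl, mrg]
    by_cases h1 : p i = u
    · simp [h1]
    · have : i ≠ i0 := by rintro rfl; exact h1 hi0
      simp [h1, this]
  have hz := H _ (W_mrg p t u htu i0 hi0 hle)
  apply sq_dvd
  · simp
  · rw [rename_rename, hcomp, hz]
  · have : pderiv (Sum.inr i0) (rename (spl p u) f) = rename (spl p u) (pderiv i0 f) := by
      rw [pderiv_rename', sum_eq_single i0]
      · simp [spl, hi0]
      · intro i _ hi
        have : spl p u i ≠ Sum.inr i0 := by
          simp only [spl]; split_ifs <;> simp [hi]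
        simp [this]
      · simp
    rw [this, rename_rename, hcomp]
    exact rename_pderiv_zero _ f hf i0 hz

theorem pair_dvd {s : ℕ} {T : Type} (p : Fin s → T) (t u : T) (htu : t ≠ u)
    (hle : fib p u ≤ fib p t) (f : MvPolynomial (Fin s) ℂ) (hf : f.IsSymmetric)
    (H : ∀ (q : Fin s → T ⊕ Fin s), W p < W q → rename q f = 0) :
    (X u - X t) ^ (2 * fib p u) ∣ rename p f := by
  classical
  have h1 : ∏ i ∈ univ.filter (fun i => p i = u),
      (X (Sum.inr i) - X (Sum.inl t) : MvPolynomial (T ⊕ Fin s) ℂ) ^ 2 ∣ rename (spl p u) f := by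
    apply Finset.prod_dvd_of_isRelPrime
    · intro i _ j _ hij
      apply relPrime_of_not_dvd (by simp)
      rw [X_sub_X_dvd_iff, map_sub, rename_X, rename_X, rep_eq, rep_eq, sub_eq_zero,
        X_injective.eq_iff]
      simp [Ne.symm hij]
    · intro i hi
      exact split_dvd p t u htu hle f hf H i (by simpa using hi)
  have h2 := map_dvd (rename (Sum.elim id (fun _ => u)) :
    MvPolynomial (T ⊕ Fin s) ℂ →ₐ[ℂ] MvPolynomial T ℂ) h1
  rw [map_prod, rename_rename] at h2
  have h3 : Sum.elim id (fun _ => u) ∘ spl p u = p := by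
    funext i
    simp only [Function.comp_apply, spl]
    split_ifs with h
    · simp [h]
    · simp
  rw [h3] at h2
  rw [fib_eq]
  simpa [prod_const, ← pow_mul] using h2

end FB
namespace FB

open MvPolynomial Finset

/-- linearised conditions -/
def Good (k l s : ℕ) (m : Fin k → ℕ) : Submodule ℂ (MvPolynomial (Fin s) ℂ) where
  carrier := {f | f.IsSymmetric ∧
    (∀ a : ℕ, 1 ≤ a → a ≤ s → ∀ d : ℕ,
      (Ma k m a : ℤ) - (a : ℤ) < (d : ℤ) → (spec s a f).coeff d = 0) ∧
    (∀ d : Fin s →₀ ℕ, ¬ ((∀ i, 1 ≤ d i) ∧ (univ.filter fun i => d i = 1).card ≤ k - l) →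
      coeff d f = 0)}
  zero_mem' := by
    refine ⟨?_, ?_, ?_⟩
    · intro e; simp
    · intros; simp [spec]
    · intros; simp
  add_mem' := by
    rintro f g ⟨h1, h2, h3⟩ ⟨h1', h2', h3'⟩
    refine ⟨?_, ?_, ?_⟩
    · exact h1.add h1'
    · intro a ha has d hd
      have e1 := h2 a ha has d hd
      have e2 := h2' a ha has d hd
      unfold spec at *
      rw [map_add, Polynomial.coeff_add, e1, e2, add_zero]
    · intro d hd
      rw [coeff_add, h3 d hd, h3' d hd, add_zero]
  smul_mem' := by
    rintro c f ⟨h1, h2, h3⟩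
    refine ⟨?_, ?_, ?_⟩
    · exact h1.smul c
    · intro a ha has d hd
      have e1 := h2 a ha has d hd
      unfold spec at *
      rw [map_smul, Polynomial.coeff_smul, e1, smul_zero]
    · intro d hd
      rw [coeff_smul, h3 d hd, smul_zero]

theorem exists_perm_set {s : ℕ} (A : Finset (Fin s)) :
    ∃ σ : Equiv.Perm (Fin s), ∀ i, (σ i).val < A.card ↔ i ∈ A := by
  classical
  have hA : A.card ≤ s := (card_le_univ _).trans (by simp)
  have h1 : fib (fun i : Fin s => decide (i ∈ A)) true = A.card := by
    rw [fib_eq]; congr 1; ext i; simp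
  have h2 : fib (fun i : Fin s => decide (i.val < A.card)) true = A.card := by
    rw [fib_eq]
    have : (univ.filter fun i : Fin s => decide (i.val < A.card) = true).card
      = (univ.filter fun i : Fin s => i.val < A.card).card := by simp
    rw [this, Fin.card_filter_val_lt]
    omega
  have h3 := sum_fib (fun i : Fin s => decide (i ∈ A))
  have h4 := sum_fib (fun i : Fin s => decide (i.val < A.card))
  rw [Fintype.sum_bool] at h3 h4
  obtain ⟨σ, hσ⟩ := exists_perm (fun i : Fin s => decide (i ∈ A))
    (fun i : Fin s => decide (i.val < A.card)) (by
      intro b; cases b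
      · omega
      · omega)
  refine ⟨σ, fun i => ?_⟩
  have := hσ i
  simpa using this

theorem zeroFirst_supp {s c : ℕ} {f : MvPolynomial (Fin s) ℂ} (h : zeroFirst s c f = 0)
    {d : Fin s →₀ ℕ} (hd : coeff d f ≠ 0) : ∃ i : Fin s, i.val < c ∧ d i ≠ 0 := by
  classical
  have hmem : f ∈ Ideal.span (X '' {i : Fin s | i.val < c} : Set (MvPolynomial (Fin s) ℂ)) := by
    rw [← Ideal.Quotient.eq_zero_iff_mem]
    set I := Ideal.span (X '' {i : Fin s | i.val < c} : Set (MvPolynomial (Fin s) ℂ)) with hI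
    have : (Ideal.Quotient.mkₐ ℂ I) = (Ideal.Quotient.mkₐ ℂ I).comp
        (MvPolynomial.aeval (fun i : Fin s =>
          if (i : ℕ) < c then (0 : MvPolynomial (Fin s) ℂ) else MvPolynomial.X i)) := by
      apply algHom_ext
      intro i
      simp only [AlgHom.comp_apply, aeval_X]
      split_ifs with hi
      · rw [map_zero]
        simp only [Ideal.Quotient.mkₐ_eq_mk]
        rw [Ideal.Quotient.eq_zero_iff_mem]
        exact Ideal.subset_span ⟨i, hi, rfl⟩
      · rfl
    have h2 := congrArg (fun φ => φ f) this
    unfold zeroFirst at h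
    simp only [AlgHom.comp_apply, h, map_zero] at h2
    exact h2
  rw [mem_ideal_span_X_image] at hmem
  obtain ⟨i, hi, hi'⟩ := hmem d (mem_support_iff.2 hd)
  exact ⟨i, hi, hi'⟩

theorem coeff_sym {s : ℕ} {f : MvPolynomial (Fin s) ℂ} (hf : f.IsSymmetric)
    (σ : Equiv.Perm (Fin s)) (d : Fin s →₀ ℕ) :
    coeff (d.mapDomain σ) f = coeff d f := by
  conv_lhs => rw [← hf σ]
  exact coeff_rename_mapDomain σ σ.injective f d

theorem FSpace_le (k l s : ℕ) (m : Fin k → ℕ) :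
    Submodule.span ℂ (FSpace k l s m) ≤ Good k l s m := by
  classical
  rw [Submodule.span_le]
  rintro f ⟨h1, h2, h3, h4⟩
  refine ⟨h1, h2, ?_⟩
  have hZ1 : ∀ d : Fin s →₀ ℕ, coeff d f ≠ 0 → ∀ i, 1 ≤ d i := by
    intro d hd i
    have h0 : 0 < s := i.pos
    have := coeff_sym h1 (Equiv.swap i ⟨0, h0⟩) d
    rw [← this] at hd
    obtain ⟨j, hj, hj'⟩ := zeroFirst_supp h3 hd
    have : j = ⟨0, h0⟩ := by ext; show j.val = 0; omega
    subst this
    rw [Finsupp.mapDomain_equiv_apply] at hj'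
    simp at hj'
    omega
  set one : Fin s →₀ ℕ := Finsupp.equivFunOnFinite.symm (fun _ => 1) with hone
  have hone1 : ∀ i, one i = 1 := fun i => by simp [one]
  have hmon : (∏ i, X i : MvPolynomial (Fin s) ℂ) = monomial one 1 := by
    rw [monomial_eq, Finsupp.prod_fintype _ _ (by simp)]
    simp [hone1]
  have hdiv : monomial one (1 : ℂ) ∣ f := by
    rw [monomial_one_dvd_iff_modMonomial_eq_zero]
    ext d
    rw [coeff_zero]
    by_cases hd : one ≤ d
    · exact coeff_modMonomial_of_le _ hd
    · rw [coeff_modMonomial_of_not_le _ hd]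
      by_contra hne
      exact hd (fun i => by rw [hone1]; exact hZ1 d hne i)
  obtain ⟨g, hg⟩ := hdiv
  intro d hd
  by_contra hne
  apply hd
  refine ⟨hZ1 d hne, ?_⟩
  by_contra! hcard
  have hs : k - l + 1 ≤ s := (Nat.succ_le_of_lt hcard).trans ((card_le_univ _).trans (Fintype.card_fin s).le)
  have hz := h4 hs g (by rw [hmon]; exact hg)
  obtain ⟨A, hA, hAc⟩ := exists_subset_card_eq (n := k - l + 1) hcard
  obtain ⟨σ, hσ⟩ := exists_perm_set A
  obtain ⟨e, he⟩ : ∃ e, e = d.mapDomain σ := ⟨_, rfl⟩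
  have hee : coeff e f ≠ 0 := by rw [he, coeff_sym h1]; exact hne
  have hle : one ≤ e := fun i => by rw [hone1]; exact hZ1 e hee i
  obtain ⟨e', rfl⟩ : ∃ e', e = one + e' := ⟨e - one, (add_tsub_cancel_of_le hle).symm⟩
  rw [hg, coeff_monomial_mul, one_mul] at hee
  obtain ⟨i, hi, hi'⟩ := zeroFirst_supp hz hee
  rw [← hAc] at hi
  have h5 : σ.symm i ∈ A := by rw [← hσ, Equiv.apply_symm_apply]; exact hi
  have h6 := hA h5
  simp only [mem_filter, mem_univ, true_and] at h6
  have h7 := DFunLike.congr_fun he i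
  rw [Finsupp.mapDomain_equiv_apply, h6, Finsupp.add_apply, hone1] at h7
  omega

/-- view as a polynomial in the variable `t` -/
def HH {T : Type} (t : T) : MvPolynomial T ℂ →ₐ[ℂ] Polynomial (MvPolynomial T ℂ) := by
  classical
  exact aeval (fun x => if x = t then Polynomial.X else Polynomial.C (X x))

theorem HH_monomial {T : Type} (t : T) (u : T →₀ ℕ) (a : ℂ) :
    HH t (monomial u a) = Polynomial.monomial (u t) (monomial (u.erase t) a) := by
  classical
  unfold HH
  rw [aeval_monomial, ← Finsupp.mul_prod_erase' u t _ (by simp), if_pos rfl]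
  have h1 : ((u.erase t).prod fun i k =>
      (if i = t then Polynomial.X else Polynomial.C (X i : MvPolynomial T ℂ)) ^ k) =
      Polynomial.C ((u.erase t).prod fun i k => (X i : MvPolynomial T ℂ) ^ k) := by
    rw [Finsupp.prod, Finsupp.prod, map_prod]
    refine prod_congr rfl fun i hi => ?_
    have : i ≠ t := by rintro rfl; simp at hi
    rw [if_neg this, map_pow]
  rw [h1, ← Polynomial.C_mul_X_pow_eq_monomial, monomial_eq, map_mul]
  have h2 : (algebraMap ℂ (Polynomial (MvPolynomial T ℂ))) a = Polynomial.C (C a) := rfl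
  rw [h2]
  ring

theorem HH_coeff {T : Type} (t : T) (g : MvPolynomial T ℂ) (e : T →₀ ℕ) :
    coeff (e.erase t) ((HH t g).coeff (e t)) = coeff e g := by
  classical
  induction g using MvPolynomial.induction_on' with
  | monomial u a =>
    rw [HH_monomial, Polynomial.coeff_monomial, coeff_monomial]
    by_cases h : u = e
    · subst h; simp
    · rw [if_neg h]
      split_ifs with h1
      · rw [coeff_monomial, if_neg]
        intro h2
        apply h
        ext x
        by_cases hx : x = t
        · rw [hx, h1]
        · have := DFunLike.congr_fun h2 x
          rwa [Finsupp.erase_ne hx, Finsupp.erase_ne hx] at this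
      · simp
  | add p q hp hq => rw [map_add, Polynomial.coeff_add, coeff_add, coeff_add, hp, hq]

theorem deg_bound {k l s : ℕ} {m : Fin k → ℕ} {f : MvPolynomial (Fin s) ℂ}
    (hf : f ∈ Good k l s m) {T : Type} (p : Fin s → T) (t : T) (ht : 1 ≤ fib p t)
    (hne : rename p f ≠ 0) :
    (degreeOf t (rename p f) : ℤ) ≤ (Ma k m (fib p t) : ℤ) - (fib p t : ℤ) := by
  classical
  obtain ⟨h1, h2, -⟩ := hf
  obtain ⟨σ, hσ⟩ := exists_perm_set (univ.filter fun i => p i = t)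
  rw [← fib_eq p t] at hσ
  have hp1 : rename p f = rename (p ∘ σ.symm) f := by
    conv_lhs => rw [← h1 σ.symm]
    rw [rename_rename]
  have hit : ∀ i, (p ∘ σ.symm) i = t ↔ i.val < fib p t := by
    intro i
    have := hσ (σ.symm i)
    rw [Equiv.apply_symm_apply] at this
    rw [this]; simp
  have hspec : HH t (rename p f) =
      Polynomial.map (rename (p ∘ σ.symm) : MvPolynomial (Fin s) ℂ →ₐ[ℂ] MvPolynomial T ℂ).toRingHom
        (spec s (fib p t) f) := by
    rw [hp1]
    have : (HH t).comp (rename (p ∘ σ.symm)) =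
      (Polynomial.mapAlgHom (rename (p ∘ σ.symm) :
        MvPolynomial (Fin s) ℂ →ₐ[ℂ] MvPolynomial T ℂ)).comp
      (MvPolynomial.aeval (fun i : Fin s =>
        if (i : ℕ) < fib p t then (Polynomial.X : Polynomial (MvPolynomial (Fin s) ℂ))
        else Polynomial.C (MvPolynomial.X i))) := by
      apply algHom_ext
      intro i
      simp only [AlgHom.comp_apply, rename_X, aeval_X, HH]
      by_cases hi : i.val < fib p t
      · rw [if_pos hi, if_pos ((hit i).2 hi)]
        simp
      · rw [if_neg hi, if_neg (fun h => hi ((hit i).1 h))]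
        simp
    exact congrArg (fun φ => φ f) this
  have hb : ∀ d ∈ (rename p f).support, (d t : ℤ) ≤ (Ma k m (fib p t) : ℤ) - (fib p t : ℤ) := by
    intro d hd
    by_contra! hlt
    have h3 := h2 _ ht (fib_le p t) _ hlt
    rw [mem_support_iff, ← HH_coeff t, hspec, Polynomial.coeff_map, h3] at hd
    simp at hd
  obtain ⟨d0, hd0⟩ := support_nonempty.2 hne
  have hb0 := hb d0 hd0
  have : degreeOf t (rename p f) ≤ ((Ma k m (fib p t) : ℤ) - (fib p t : ℤ)).toNat := by
    rw [degreeOf_le_iff]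
    intro d hd
    have := hb d hd
    omega
  omega

theorem X_pow_dvd {k l s : ℕ} {m : Fin k → ℕ} {f : MvPolynomial (Fin s) ℂ}
    (hf : f ∈ Good k l s m) {T : Type} (p : Fin s → T) (t : T) :
    (X t : MvPolynomial T ℂ) ^ (fib p t + (fib p t - (k - l))) ∣ rename p f := by
  classical
  obtain ⟨-, -, h3⟩ := hf
  conv_rhs => rw [f.as_sum, map_sum]
  refine dvd_sum fun d hd => ?_
  rw [mem_support_iff] at hd
  have hd' := not_imp_comm.1 (h3 d) hd
  rw [rename_monomial, X_pow_eq_monomial, monomial_dvd_monomial]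
  refine ⟨Or.inr ?_, one_dvd _⟩
  rw [Finsupp.single_le_iff]
  have hmd : (d.mapDomain p) t = ∑ i ∈ univ.filter (fun i => p i = t), d i := by
    rw [Finsupp.mapDomain, Finsupp.sum_fintype _ _ (by simp), Finsupp.finsetSum_apply, sum_filter]
    refine sum_congr rfl fun i _ => ?_
    rw [Finsupp.single_apply]
  rw [hmd]
  have hA : fib p t ≤ ∑ i ∈ univ.filter (fun i => p i = t), d i := by
    rw [fib_eq, card_eq_sum_ones]
    exact sum_le_sum fun i _ => hd'.1 i
  have hB : 2 * fib p t ≤ ∑ i ∈ univ.filter (fun i => p i = t), d i + (k - l) := by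
    have : ∑ i ∈ univ.filter (fun i => p i = t), 2 ≤
        ∑ i ∈ univ.filter (fun i => p i = t), (d i + if d i = 1 then 1 else 0) := by
      refine sum_le_sum fun i _ => ?_
      have := hd'.1 i
      split_ifs <;> omega
    rw [sum_const, ← fib_eq p t, sum_add_distrib] at this
    have h5 : ∑ i ∈ univ.filter (fun i => p i = t), (if d i = 1 then 1 else 0) ≤ k - l := by
      refine le_trans (sum_le_sum_of_subset (subset_univ _)) ?_
      rw [← card_filter]
      exact hd'.2
    simp only [smul_eq_mul] at this
    omega
  omega

end FB
namespace FB

open MvPolynomial Finset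

/-- Vandermonde part -/
def QA {T : Type} [Fintype T] (n : T → ℕ) : MvPolynomial T ℂ := by
  classical
  exact ∏ x ∈ (univ : Finset T).offDiag, (X x.1 - X x.2) ^ min (n x.1) (n x.2)

/-- monomial part -/
def QB {T : Type} [Fintype T] (c : ℕ) (n : T → ℕ) : MvPolynomial T ℂ :=
  ∏ t, X t ^ (n t + (n t - c))

theorem QA_eq {T : Type} [Fintype T] [DecidableEq T] (n : T → ℕ) :
    QA n = ∏ x ∈ (univ : Finset T).offDiag,
      (X x.1 - X x.2 : MvPolynomial T ℂ) ^ min (n x.1) (n x.2) := by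
  unfold QA
  congr!

theorem QA_dvd {s : ℕ} {T : Type} [Fintype T] (p : Fin s → T)
    (f : MvPolynomial (Fin s) ℂ) (hf : f.IsSymmetric)
    (H : ∀ (q : Fin s → T ⊕ Fin s), W p < W q → rename q f = 0) :
    QA (fib p) ∣ rename p f := by
  classical
  rw [QA_eq]
  set e := Fintype.equivFin T
  set S := (univ : Finset T).offDiag.filter fun x => e x.1 < e x.2 with hS
  have hSne : ∀ x ∈ S, x.1 ≠ x.2 := by
    intro x hx; simp [S] at hx; exact hx.1
  have h1 : ∏ x ∈ (univ : Finset T).offDiag,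
      (X x.1 - X x.2 : MvPolynomial T ℂ) ^ min (fib p x.1) (fib p x.2) =
      (∏ x ∈ S, (-1 : MvPolynomial T ℂ) ^ min (fib p x.1) (fib p x.2)) *
        ∏ x ∈ S, (X x.1 - X x.2 : MvPolynomial T ℂ) ^ (2 * min (fib p x.1) (fib p x.2)) := by
    rw [← prod_filter_mul_prod_filter_not _ (fun x => e x.1 < e x.2), ← hS]
    have h2 : ∏ x ∈ (univ : Finset T).offDiag.filter (fun x => ¬ e x.1 < e x.2),
        (X x.1 - X x.2 : MvPolynomial T ℂ) ^ min (fib p x.1) (fib p x.2) =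
        ∏ x ∈ S, (X x.2 - X x.1 : MvPolynomial T ℂ) ^ min (fib p x.2) (fib p x.1) := by
      refine prod_bij (fun x _ => x.swap) ?_ ?_ ?_ ?_
      · intro x hx
        simp only [mem_filter, mem_offDiag, mem_univ, true_and, S, Prod.fst_swap,
          Prod.snd_swap] at hx ⊢
        exact ⟨Ne.symm hx.1, lt_of_le_of_ne (not_lt.1 hx.2)
          (fun h => hx.1 (e.injective h).symm)⟩
      · intro x _ y _ h; exact Prod.swap_injective h
      · intro x hx
        refine ⟨x.swap, ?_, by simp⟩
        simp only [mem_filter, mem_offDiag, mem_univ, true_and, S, Prod.fst_swap,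
          Prod.snd_swap] at hx ⊢
        exact ⟨Ne.symm hx.1, not_lt.2 hx.2.le⟩
      · intro x _; simp
    rw [h2, ← prod_mul_distrib, ← prod_mul_distrib]
    refine prod_congr rfl fun x _ => ?_
    rw [min_comm (fib p x.2), ← mul_pow, pow_mul, ← mul_pow]
    congr 1
    ring
  rw [h1]
  have hu : IsUnit (∏ x ∈ S, (-1 : MvPolynomial T ℂ) ^ min (fib p x.1) (fib p x.2)) := by
    rw [prod_pow_eq_pow_sum]
    exact (isUnit_one.neg).pow _
  rw [hu.mul_left_dvd]
  apply Finset.prod_dvd_of_isRelPrime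
  · intro x hx y hy hxy
    apply relPrime_of_not_dvd (hSne x hx)
    rw [X_sub_X_dvd_iff, map_sub, rename_X, rename_X, rep_eq, rep_eq, sub_eq_zero,
        X_injective.eq_iff]
    have hx' := hSne x hx
    have hy' := hSne y hy
    obtain ⟨a, b⟩ := x
    obtain ⟨c, d⟩ := y
    simp only [S, coe_filter, Set.mem_ofPred_eq] at hx hy
    have hx2 := hx.2
    have hy2 := hy.2
    simp only at hx2 hy2 hx' hy' ⊢
    split_ifs with h2 h3 h3
    · intro _; exact hy' (h2.trans h3.symm)
    · rintro rfl; subst h2; exact hxy rfl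
    · rintro rfl; subst h3; exact absurd hx2 (not_lt.2 hy2.le)
    · exact hy'
  · rintro ⟨t, u⟩ hx
    have htu : t ≠ u := hSne _ hx
    simp only
    rcases le_total (fib p t) (fib p u) with h | h
    · rw [min_eq_left h]
      exact pair_dvd p u t htu.symm h f hf H
    · rw [min_eq_right h]
      have := pair_dvd p t u htu h f hf H
      rw [pow_mul] at this ⊢
      have h2 : (X t - X u : MvPolynomial T ℂ) ^ 2 = (X u - X t) ^ 2 := by ring
      rwa [h2]

theorem QAB_dvd {k l s : ℕ} {m : Fin k → ℕ} {f : MvPolynomial (Fin s) ℂ}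
    (hf : f ∈ Good k l s m) {T : Type} [Fintype T] (p : Fin s → T)
    (H : ∀ (q : Fin s → T ⊕ Fin s), W p < W q → rename q f = 0) :
    QA (fib p) * QB (k - l) (fib p) ∣ rename p f := by
  classical
  refine IsRelPrime.mul_dvd ?_ (QA_dvd p f hf.1 H) ?_
  · rw [QA_eq]
    apply IsRelPrime.prod_left
    intro x hx
    apply IsRelPrime.prod_right
    intro t _
    apply IsRelPrime.pow
    have hne : x.1 ≠ x.2 := by simpa using hx
    refine (X_sub_X_prime hne).irreducible.isRelPrime_iff_not_dvd.2 ?_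
    rw [X_sub_X_dvd_iff, rename_X]
    exact X_ne_zero _
  · apply Finset.prod_dvd_of_isRelPrime
    · intro t _ u _ htu
      apply IsRelPrime.pow
      refine (X_prime).irreducible.isRelPrime_iff_not_dvd.2 ?_
      rw [X_dvd_X]
      exact htu
    · intro t _
      exact X_pow_dvd hf p t

theorem QA_ne {T : Type} [Fintype T] (n : T → ℕ) : QA n ≠ 0 := by
  classical
  rw [QA_eq, prod_ne_zero_iff]
  intro x hx
  exact pow_ne_zero _ (X_sub_X_ne (by simpa using hx))

theorem QB_ne {T : Type} [Fintype T] (c : ℕ) (n : T → ℕ) : QB c n ≠ 0 := by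
  unfold QB
  rw [prod_ne_zero_iff]
  intro x hx
  exact pow_ne_zero _ (X_ne_zero _)

theorem one_le_degreeOf {T : Type} {t u : T} (h : t ≠ u) :
    1 ≤ degreeOf t (X t - X u : MvPolynomial T ℂ) := by
  classical
  have : Finsupp.single t 1 ∈ (X t - X u : MvPolynomial T ℂ).support := by
    have h1 : (Finsupp.single u 1 : T →₀ ℕ) ≠ Finsupp.single t 1 :=
      fun h' => h (Finsupp.single_left_injective one_ne_zero h').symm
    rw [mem_support_iff, coeff_sub, coeff_X, coeff_X, if_pos rfl, if_neg h1]
    simp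
  have := le_degreeOf_of_mem_support t this
  simpa using this

theorem degreeOf_QA {T : Type} [Fintype T] [DecidableEq T] (n : T → ℕ) (t : T) :
    2 * ∑ u ∈ univ.erase t, min (n t) (n u) ≤ degreeOf t (QA n) := by
  rw [QA_eq, degreeOf_prod_eq _ _ (fun x hx => pow_ne_zero _ (X_sub_X_ne (by simpa using hx)))]
  have h1 : ∑ x ∈ (univ : Finset T).offDiag,
      ((if x.1 = t then min (n x.1) (n x.2) else 0) +
        (if x.2 = t then min (n x.1) (n x.2) else 0)) ≤
      ∑ x ∈ (univ : Finset T).offDiag,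
        degreeOf t ((X x.1 - X x.2 : MvPolynomial T ℂ) ^ min (n x.1) (n x.2)) := by
    refine sum_le_sum fun x hx => ?_
    have hne : x.1 ≠ x.2 := by simpa using hx
    rw [degreeOf_pow_eq _ _ _ (X_sub_X_ne hne)]
    split_ifs with h1 h2 h2
    · exact absurd (h1.trans h2.symm) hne
    · have := one_le_degreeOf hne
      rw [h1] at this ⊢
      rw [add_zero]
      exact Nat.le_mul_of_pos_right _ this
    · have h3 := one_le_degreeOf hne.symm
      rw [← neg_sub, degreeOf_neg] at h3
      rw [h2] at h3 ⊢
      rw [zero_add]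
      exact Nat.le_mul_of_pos_right _ h3
    · simp
  refine le_trans (le_of_eq ?_) h1
  have hoff : (univ : Finset T).offDiag = (univ ×ˢ univ).filter fun x => x.1 ≠ x.2 := by
    ext x; simp
  rw [sum_add_distrib, two_mul]
  congr 1
  · rw [hoff, sum_filter, sum_product]
    symm
    rw [sum_eq_single t]
    · rw [← filter_ne' univ t, sum_filter]
      refine sum_congr rfl fun u _ => ?_
      by_cases hu : u = t
      · simp [hu]
      · simp [hu, Ne.symm hu]
    · intro b _ hb; simp [hb]
    · simp
  · rw [hoff, sum_filter, sum_product_right]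
    symm
    rw [sum_eq_single t]
    · rw [← filter_ne' univ t, sum_filter]
      refine sum_congr rfl fun u _ => ?_
      by_cases hu : u = t
      · simp [hu]
      · simp [hu, min_comm]
    · intro b _ hb; simp [hb]
    · simp

theorem degreeOf_QB {T : Type} [Fintype T] (c : ℕ) (n : T → ℕ) (t : T) :
    n t + (n t - c) ≤ degreeOf t (QB c n) := by
  classical
  unfold QB
  rw [degreeOf_prod_eq _ _ (fun x hx => pow_ne_zero _ (X_ne_zero _))]
  refine le_trans (le_of_eq ?_) (single_le_sum (f := fun u =>
    degreeOf t ((X u : MvPolynomial T ℂ) ^ (n u + (n u - c)))) (fun _ _ => Nat.zero_le _)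
    (mem_univ t))
  simp

theorem quot_bound {k l s : ℕ} {m : Fin k → ℕ} {f : MvPolynomial (Fin s) ℂ}
    (hf : f ∈ Good k l s m) {T : Type} [Fintype T] [DecidableEq T] (p : Fin s → T)
    (hne : rename p f ≠ 0) (h : MvPolynomial T ℂ)
    (hh : rename p f = QA (fib p) * QB (k - l) (fib p) * h) (t : T) (ht : 1 ≤ fib p t) :
    (degreeOf t h : ℤ) + 2 * ∑ u ∈ univ.erase t, (min (fib p t) (fib p u) : ℤ) +
      fib p t + (fib p t - (k - l) : ℕ) ≤ (Ma k m (fib p t) : ℤ) - fib p t := by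
  have h1 := deg_bound hf p t ht hne
  have hhne : h ≠ 0 := by rintro rfl; exact hne (by simpa using hh)
  rw [hh, degreeOf_mul_eq (mul_ne_zero (QA_ne _) (QB_ne _ _)) hhne,
    degreeOf_mul_eq (QA_ne _) (QB_ne _ _)] at h1
  have h2 := degreeOf_QA (fib p) t
  have h3 := degreeOf_QB (k - l) (fib p) t
  zify at h2
  push_cast at h1
  have h3' : ((fib p t : ℤ) + ((fib p t - (k - l) : ℕ) : ℤ)) ≤
    (degreeOf t (QB (k - l) (fib p)) : ℤ) := by exact_mod_cast h3
  linarith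

theorem big_zero {k l s : ℕ} {m : Fin k → ℕ} (hl : l ≤ k) (hs : wt k m = 2 * s + l)
    {f : MvPolynomial (Fin s) ℂ} (hf : f ∈ Good k l s m) :
    ∀ (N : ℕ) (T : Type) [Fintype T] (p : Fin s → T), s * (s + 2) ^ s - W p < N →
      (∃ t, k < fib p t) → rename p f = 0 := by
  classical
  intro N
  induction N with
  | zero => intro T _ p h; omega
  | succ N ih =>
    rintro T _ p hN ⟨t0, ht0⟩
    by_contra hne
    have H : ∀ (q : Fin s → T ⊕ Fin s), W p < W q → rename q f = 0 := by
      intro q hq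
      refine ih _ q ?_ (W_big p q hq t0 ht0)
      have := W_le q
      omega
    obtain ⟨h, hh⟩ := QAB_dvd hf p H
    obtain ⟨t, -, ht⟩ := exists_max_image (univ : Finset T) (fib p) ⟨t0, mem_univ _⟩
    have htk : k < fib p t := lt_of_lt_of_le ht0 (ht t0 (mem_univ _))
    have hb := quot_bound hf p hne h hh t (by omega)
    have h1 : ∑ u ∈ univ.erase t, (min (fib p t) (fib p u) : ℤ) =
        ∑ u ∈ univ.erase t, (fib p u : ℤ) := by
      refine sum_congr rfl fun u _ => ?_
      have := ht u (mem_univ _)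
      rw [min_eq_right]
      exact_mod_cast this
    have h2 := sum_fib p
    rw [← add_sum_erase _ _ (mem_univ t)] at h2
    have h3 : (fib p t : ℤ) + ∑ u ∈ univ.erase t, (fib p u : ℤ) = s := by exact_mod_cast h2
    have h4 : Ma k m (fib p t) = wt k m := by
      unfold Ma wt
      refine sum_congr rfl fun i _ => ?_
      rw [min_eq_right]
      have := i.isLt
      omega
    rw [h1, h4, hs] at hb
    push_cast at hb
    omega

end FB
namespace FB

open MvPolynomial Finset

theorem filt {ι V : Type} [AddCommGroup V] [Module ℂ V] (U : ι → Type)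
    [∀ i, AddCommGroup (U i)] [∀ i, Module ℂ (U i)] (φ : ∀ i, V →ₗ[ℂ] U i)
    (w : ι → ℕ) (d : ι → ℕ) (S : Finset ι) : ∀ G : Submodule ℂ V,
    (∀ f ∈ G, (∀ i ∈ S, φ i f = 0) → f = 0) →
    (∀ i ∈ S, ∀ G' ≤ G, (∀ f ∈ G', ∀ j ∈ S, w i < w j → φ j f = 0) →
      FiniteDimensional ℂ (G'.map (φ i)) ∧ Module.finrank ℂ (G'.map (φ i)) ≤ d i) →
    FiniteDimensional ℂ G ∧ Module.finrank ℂ G ≤ ∑ i ∈ S, d i := by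
  classical
  induction S using Finset.induction_on_max_value w with
  | empty =>
    intro G h1 _
    have : G = ⊥ := by
      rw [eq_bot_iff]; intro f hf
      exact h1 f hf (by simp)
    subst this
    exact ⟨inferInstance, by simp⟩
  | insert a S ha hmax ih =>
    intro G h1 h2
    obtain ⟨k1, k2⟩ := h2 a (mem_insert_self _ _) G le_rfl (by
      intro f _ j hj hlt
      rcases mem_insert.1 hj with rfl | hj
      · omega
      · have := hmax j hj; omega)
    obtain ⟨i1, i2⟩ := ih (G ⊓ LinearMap.ker (φ a)) (by
        rintro f ⟨hf, hf'⟩ h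
        refine h1 f hf fun i hi => ?_
        rcases mem_insert.1 hi with rfl | hi
        · exact hf'
        · exact h i hi) (by
        intro i hi G' hG' hG''
        refine h2 i (mem_insert_of_mem hi) G' (hG'.trans inf_le_left) ?_
        intro f hf j hj hlt
        rcases mem_insert.1 hj with rfl | hj
        · exact (hG' hf).2
        · exact hG'' f hf j hj hlt)
    have hfg : G.FG := Submodule.fg_of_fg_map_of_fg_inf_ker (φ a)
      (Module.Finite.iff_fg.1 k1) (Module.Finite.iff_fg.1 i1)
    have hfd : FiniteDimensional ℂ G := Module.Finite.iff_fg.2 hfg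
    refine ⟨hfd, ?_⟩
    have h3 := LinearMap.finrank_range_add_finrank_ker ((φ a).domRestrict G)
    rw [LinearMap.range_domRestrict] at h3
    have h4 : (LinearMap.ker ((φ a).domRestrict G)).map G.subtype = G ⊓ LinearMap.ker (φ a) := by
      ext x
      simp only [Submodule.mem_map, LinearMap.mem_ker, Submodule.mem_inf]
      constructor
      · rintro ⟨y, hy, rfl⟩; exact ⟨y.2, hy⟩
      · rintro ⟨hx, hx'⟩; exact ⟨⟨x, hx⟩, hx', rfl⟩
    have h5 := Submodule.finrank_map_subtype_eq G (LinearMap.ker ((φ a).domRestrict G))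
    rw [h4] at h5
    rw [sum_insert ha]
    omega

/-- block symmetric polynomials with bounded degrees -/
def Hsp {k : ℕ} (v D : Fin k → ℕ) : Submodule ℂ (MvPolynomial (Σ a : Fin k, Fin (v a)) ℂ) where
  carrier := {h | (∀ τ : ∀ a, Equiv.Perm (Fin (v a)),
      rename (Equiv.sigmaCongrRight τ) h = h) ∧
    ∀ e : (Σ a : Fin k, Fin (v a)) →₀ ℕ, (∃ t, D t.1 < e t) → coeff e h = 0}
  zero_mem' := by
    refine ⟨fun τ => map_zero _, fun e _ => coeff_zero e⟩
  add_mem' := by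
    rintro f g ⟨h1, h2⟩ ⟨h1', h2'⟩
    refine ⟨fun τ => ?_, fun e he => ?_⟩
    · rw [map_add, h1, h1']
    · rw [coeff_add, h2 e he, h2' e he, add_zero]
  smul_mem' := by
    rintro c f ⟨h1, h2⟩
    refine ⟨fun τ => ?_, fun e he => ?_⟩
    · rw [map_smul, h1]
    · rw [coeff_smul, h2 e he, smul_zero]

theorem exists_vec {α : Type} {n : ℕ} (z : Sym α n) :
    ∃ x : Fin n → α, (univ : Finset (Fin n)).val.map x = z.1 := by
  obtain ⟨z, hz⟩ := z
  induction z using Quotient.inductionOn with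
  | h l =>
    subst hz
    refine ⟨fun i => l.get i, ?_⟩
    rw [Fin.univ_val_map]
    exact congrArg _ (List.ofFn_get l)

/-- a representative -/
def vec {α : Type} {n : ℕ} (z : Sym α n) : Fin n → α := (exists_vec z).choose

theorem vec_spec {α : Type} {n : ℕ} (z : Sym α n) :
    (univ : Finset (Fin n)).val.map (vec z) = z.1 := (exists_vec z).choose_spec

theorem perm_of_map {α : Type} {n : ℕ} (x y : Fin n → α)
    (h : (univ : Finset (Fin n)).val.map x = (univ : Finset (Fin n)).val.map y) :
    ∃ σ : Equiv.Perm (Fin n), ∀ i, y (σ i) = x i := by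
  classical
  apply exists_perm
  intro t
  have := congrArg (Multiset.count t) h
  rw [Multiset.count_map, Multiset.count_map] at this
  rw [fib_eq, fib_eq]
  simpa [Finset.card, eq_comm] using this

theorem Hsp_finrank {k : ℕ} (v D : Fin k → ℕ) :
    FiniteDimensional ℂ (Hsp v D) ∧
      Module.finrank ℂ (Hsp v D) ≤ ∏ a, (D a + v a).choose (v a) := by
  classical
  let R : (∀ a, Sym (Fin (D a + 1)) (v a)) → ((Σ a : Fin k, Fin (v a)) →₀ ℕ) := fun z =>
    Finsupp.equivFunOnFinite.symm (fun t => (vec (z t.1) t.2).val)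
  let Φ : Hsp v D →ₗ[ℂ] ((∀ a, Sym (Fin (D a + 1)) (v a)) → ℂ) :=
    { toFun := fun h z => coeff (R z) h.1
      map_add' := fun f g => by funext z; simp
      map_smul' := fun c g => by funext z; simp }
  have hinj : Function.Injective Φ := by
    rw [injective_iff_map_eq_zero]
    rintro ⟨h, h1, h2⟩ h0
    ext e
    show coeff e h = coeff e 0
    rw [coeff_zero]
    by_cases he : ∃ t, D t.1 < e t
    · exact h2 e he
    push Not at he
    let x : ∀ a, Fin (v a) → Fin (D a + 1) := fun a j =>
      ⟨e ⟨a, j⟩, Nat.lt_succ_of_le (he ⟨a, j⟩)⟩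
    let z : ∀ a, Sym (Fin (D a + 1)) (v a) := fun a =>
      ⟨(univ : Finset (Fin (v a))).val.map (x a), by simp⟩
    have hp : ∀ a, ∃ σ : Equiv.Perm (Fin (v a)), ∀ i, vec (z a) (σ i) = x a i := by
      intro a
      apply perm_of_map
      rw [vec_spec]
    choose τ hτ using hp
    have hR : R z = e.mapDomain (Equiv.sigmaCongrRight τ) := by
      ext t
      rw [Finsupp.mapDomain_equiv_apply]
      obtain ⟨t, rfl⟩ := (Equiv.sigmaCongrRight τ).surjective t
      rw [Equiv.symm_apply_apply]
      obtain ⟨a, j⟩ := t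
      show (vec (z a) (τ a j)).val = e ⟨a, j⟩
      rw [hτ]
    have h3 : coeff (R z) h = 0 := congrFun h0 z
    rw [hR] at h3
    conv_lhs at h3 => rw [← h1 τ]
    rwa [coeff_rename_mapDomain _ (Equiv.injective _)] at h3
  refine ⟨FiniteDimensional.of_injective Φ hinj, ?_⟩
  refine (LinearMap.finrank_le_finrank_of_injective hinj).trans (le_of_eq ?_)
  rw [Module.finrank_fintype_fun_eq_card, Fintype.card_pi]
  refine prod_congr rfl fun a _ => ?_
  rw [Sym.card_sym_eq_choose, Fintype.card_fin]
  congr 1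
  omega

theorem concave (k : ℕ) (D : ℕ → ℤ) (h0 : D 0 = 0) (hk : D k = 0)
    (h : ∀ a, a + 1 < k → D (a + 1) < 0 → D (a + 2) + D a ≤ 2 * D (a + 1)) :
    ∀ a ≤ k, 0 ≤ D a := by
  by_contra! hc
  obtain ⟨a0, ha0, hD0⟩ := hc
  obtain ⟨b, hb, hbmin⟩ := exists_min_image (range (k + 1)) D ⟨0, by simp⟩
  have hex : ∃ c, c ≤ k ∧ D c ≤ D b := ⟨b, by simpa [Nat.lt_succ_iff] using hb, le_rfl⟩
  classical
  obtain ⟨hck, hcb⟩ := Nat.find_spec hex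
  set c := Nat.find hex with hc
  have hb0 : D b < 0 := lt_of_le_of_lt (hbmin a0 (by simp; omega)) hD0
  have hcpos : c ≠ 0 := by
    intro h'; rw [h'] at hcb; omega
  have hck' : c ≠ k := by
    intro h'; rw [h'] at hcb; omega
  obtain ⟨a, ha⟩ := Nat.exists_eq_succ_of_ne_zero hcpos
  have h1 := Nat.find_min hex (m := a) (by omega)
  have h2 := hbmin (a + 2) (by simp; omega)
  have hca : D (a + 1) ≤ D b := by
    have ha2 : c = a + 1 := ha
    rw [← ha2]; exact hcb
  have h3 := h a (by omega) (by omega)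
  have h4 : D b < D a := by
    by_contra hlt
    exact h1 ⟨by omega, not_lt.1 hlt⟩
  omega

/-- vacancy numbers -/
def Dz (k l : ℕ) (m v : Fin k → ℕ) (a : ℕ) : ℤ :=
  (∑ b : Fin k, (min (a : ℤ) ((b.1 : ℤ) + 1)) * ((m b : ℤ) - 2 * (v b : ℤ)))
    - max ((a : ℤ) - (k : ℤ) + (l : ℤ)) 0

theorem Pent_eq (k l : ℕ) (m v : Fin k → ℕ) (a : Fin k) :
    Pent k l m v a = Dz k l m v (a.1 + 1) + v a := by
  unfold Pent Dz
  push_cast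
  rfl

theorem Dz_nonneg {k l s : ℕ} (hl : l ≤ k) {m v : Fin k → ℕ} (hs : wt k m = 2 * s + l)
    (hv : ∑ a : Fin k, (a.1 + 1) * v a = s)
    (h : ∀ a : Fin k, 0 < v a → 0 ≤ Dz k l m v (a.1 + 1)) :
    ∀ a ≤ k, 0 ≤ Dz k l m v a := by
  apply concave
  · unfold Dz
    rw [max_eq_right (by push_cast; omega), sub_zero]
    refine sum_eq_zero fun b _ => ?_
    rw [min_eq_left (by push_cast; omega)]
    simp
  · unfold Dz
    rw [max_eq_left (by omega)]
    have h1 : ∑ b : Fin k, (min (k : ℤ) ((b.1 : ℤ) + 1)) * ((m b : ℤ) - 2 * (v b : ℤ)) =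
        (wt k m : ℤ) - 2 * ((∑ a : Fin k, (a.1 + 1) * v a : ℕ) : ℤ) := by
      unfold wt
      push_cast
      rw [mul_sum, ← sum_sub_distrib]
      refine sum_congr rfl fun b _ => ?_
      rw [min_eq_right (by have := b.isLt; omega)]
      ring
    rw [h1, hv, hs]
    push_cast
    ring
  · intro a ha hneg
    have hva : v ⟨a, by omega⟩ = 0 := by
      by_contra hne
      have := h ⟨a, by omega⟩ (Nat.pos_of_ne_zero hne)
      simp only at this
      omega
    have hsum : ∑ b : Fin k, (min ((a + 2 : ℕ) : ℤ) ((b.1 : ℤ) + 1)) * ((m b : ℤ) - 2 * (v b : ℤ))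
        + ∑ b : Fin k, (min (a : ℤ) ((b.1 : ℤ) + 1)) * ((m b : ℤ) - 2 * (v b : ℤ)) ≤
        2 * ∑ b : Fin k, (min ((a + 1 : ℕ) : ℤ) ((b.1 : ℤ) + 1)) * ((m b : ℤ) - 2 * (v b : ℤ)) := by
      rw [mul_sum, ← sum_add_distrib]
      refine sum_le_sum fun b _ => ?_
      by_cases hb : b.1 = a
      · have hbv : v b = 0 := by
          rw [← hva]; congr 1; exact Fin.ext hb
        rw [hbv, hb]
        have e1 : min ((a + 2 : ℕ) : ℤ) ((a : ℤ) + 1) = a + 1 := by push_cast; omega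
        have e2 : min (a : ℤ) ((a : ℤ) + 1) = a := by omega
        have e3 : min ((a + 1 : ℕ) : ℤ) ((a : ℤ) + 1) = a + 1 := by push_cast; omega
        rw [e1, e2, e3]
        push_cast
        have : (0 : ℤ) ≤ m b := by positivity
        linarith
      · have e1 : min ((a + 2 : ℕ) : ℤ) ((b.1 : ℤ) + 1) + min (a : ℤ) ((b.1 : ℤ) + 1) =
          2 * min ((a + 1 : ℕ) : ℤ) ((b.1 : ℤ) + 1) := by push_cast; omega
        rw [← add_mul, e1, mul_assoc]
    unfold Dz
    have e4 : max (((a + 2 : ℕ) : ℤ) - (k : ℤ) + (l : ℤ)) 0 + max ((a : ℤ) - (k : ℤ) + (l : ℤ)) 0 ≥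
      2 * max (((a + 1 : ℕ) : ℤ) - (k : ℤ) + (l : ℤ)) 0 := by push_cast; omega
    linarith

end FB
namespace FB

open MvPolynomial Finset

theorem QA_inv {T : Type} [Fintype T] (n : T → ℕ) (τ : Equiv.Perm T) (h : ∀ t, n (τ t) = n t) :
    rename τ (QA n) = QA n := by
  classical
  rw [QA_eq, map_prod]
  refine prod_bij (fun x _ => (τ x.1, τ x.2)) ?_ ?_ ?_ ?_
  · intro x hx; simpa using hx
  · rintro ⟨x, y⟩ _ ⟨x', y'⟩ _ hxy; simpa using hxy
  · rintro ⟨x, y⟩ hx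
    refine ⟨(τ.symm x, τ.symm y), by simpa using hx, by simp⟩
  · rintro ⟨x, y⟩ _
    simp [h]

theorem QB_inv {T : Type} [Fintype T] (c : ℕ) (n : T → ℕ) (τ : Equiv.Perm T)
    (h : ∀ t, n (τ t) = n t) :
    rename τ (QB c n) = QB c n := by
  unfold QB
  rw [map_prod]
  refine Fintype.prod_equiv τ _ _ ?_
  intro t
  simp [h]

theorem chooseP {k s : ℕ} (v : Fin k → ℕ) (hv : ∑ a : Fin k, (a.1 + 1) * v a = s) :
    ∃ p : Fin s → Σ a : Fin k, Fin (v a), ∀ t, fib p t = t.1.1 + 1 := by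
  classical
  have hc : Fintype.card (Fin s) =
      Fintype.card (Σ t : (Σ a : Fin k, Fin (v a)), Fin (t.1.1 + 1)) := by
    rw [Fintype.card_fin, Fintype.card_sigma, Fintype.sum_sigma]
    simp only [Fintype.card_fin, sum_const, card_univ, smul_eq_mul]
    rw [← hv]
    exact sum_congr rfl fun a _ => mul_comm _ _
  let e := Fintype.equivOfCardEq hc
  refine ⟨fun i => (e i).1, fun t => ?_⟩
  rw [fib_eq]
  rw [← Fintype.card_subtype, ← Fintype.card_fin (t.1.1 + 1)]
  have e2 : {x : Fin s // (e x).1 = t} ≃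
      {x : (Σ t : (Σ a : Fin k, Fin (v a)), Fin (t.1.1 + 1)) // x.1 = t} :=
    e.subtypeEquiv fun _ => Iff.rfl
  exact Fintype.card_congr (e2.trans (Equiv.sigmaSubtype t))

theorem typ {k s : ℕ} {T : Type} [Fintype T] (q : Fin s → T) (hq : ∀ t, fib q t ≤ k) :
    ∃ v : Fin k → ℕ, ∑ a : Fin k, (a.1 + 1) * v a = s ∧
      ∀ p : Fin s → Σ a : Fin k, Fin (v a), (∀ t, fib p t = t.1.1 + 1) →
        ∃ ψ : (Σ a : Fin k, Fin (v a)) → T, Function.Injective ψ ∧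
          ∃ σ : Equiv.Perm (Fin s), ∀ i, ψ (p (σ i)) = q i := by
  classical
  let v : Fin k → ℕ := fun a => Fintype.card {t : T // fib q t = a.1 + 1}
  let e : ∀ a : Fin k, {t : T // fib q t = a.1 + 1} ≃ Fin (v a) := fun a => Fintype.equivFin _
  refine ⟨v, ?_, ?_⟩
  · conv_rhs => rw [← sum_fib q]
    have h1 : ∀ t, fib q t = ∑ a : Fin k, if fib q t = a.1 + 1 then (a.1 + 1) else 0 := by
      intro t
      rcases Nat.eq_zero_or_pos (fib q t) with h0 | h0
      · rw [h0]; simp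
      · have hlt : fib q t - 1 < k := by have := hq t; omega
        rw [sum_eq_single (⟨fib q t - 1, hlt⟩ : Fin k)]
        · rw [if_pos] <;> simp <;> omega
        · intro b _ hb
          rw [if_neg]
          intro hb2
          apply hb
          ext
          simp; omega
        · simp
    rw [sum_congr rfl fun t _ => h1 t, sum_comm]
    refine sum_congr rfl fun a _ => ?_
    rw [← sum_filter, sum_const, smul_eq_mul, mul_comm]
    congr 1
    exact Fintype.card_subtype _
  · intro p hp
    let ψ : (Σ a : Fin k, Fin (v a)) → T := fun t => ((e t.1).symm t.2).1
    have hψ : ∀ t, fib q (ψ t) = t.1.1 + 1 := fun t => ((e t.1).symm t.2).2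
    have hinj : Function.Injective ψ := by
      rintro ⟨a, i⟩ ⟨b, j⟩ h
      have ha := hψ ⟨a, i⟩
      have hb := hψ ⟨b, j⟩
      rw [h, hb] at ha
      have hab : a = b := by ext; simp at ha; omega
      subst hab
      congr 1
      exact (e a).symm.injective (Subtype.ext h)
    refine ⟨ψ, hinj, ?_⟩
    apply exists_perm q (ψ ∘ p)
    intro t
    rcases Nat.eq_zero_or_pos (fib q t) with h0 | h0
    · rw [h0]
      by_contra hne
      obtain ⟨i, hi⟩ := exists_of_fib (ψ ∘ p) t (by omega)
      have := hψ (p i)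
      rw [Function.comp_apply] at hi
      rw [hi] at this
      omega
    · have hlt : fib q t - 1 < k := by have := hq t; omega
      have ht : fib q t = (⟨fib q t - 1, hlt⟩ : Fin k).1 + 1 := by simp; omega
      have : ψ ⟨⟨fib q t - 1, hlt⟩, e _ ⟨t, ht⟩⟩ = t := by simp [ψ]
      conv_rhs => rw [← this]
      rw [fib_comp_inj p ψ hinj, hp]
      exact ht

theorem rename_typ {s : ℕ} {T T' : Type} {f : MvPolynomial (Fin s) ℂ} (hf : f.IsSymmetric)
    (p : Fin s → T) (q : Fin s → T') (ψ : T → T') (σ : Equiv.Perm (Fin s))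
    (h : ∀ i, ψ (p (σ i)) = q i) : rename q f = rename ψ (rename p f) := by
  have : q = ψ ∘ p ∘ σ := by funext i; exact (h i).symm
  rw [this, ← rename_rename, ← rename_rename, hf σ]

theorem min_sum {k : ℕ} (v : Fin k → ℕ) (t : Σ a : Fin k, Fin (v a)) :
    ∑ u ∈ univ.erase t, (min ((t.1.1 + 1 : ℕ) : ℤ) ((u.1.1 + 1 : ℕ) : ℤ)) =
      ∑ b : Fin k, min ((t.1.1 + 1 : ℕ) : ℤ) ((b.1 : ℤ) + 1) * v b - (t.1.1 + 1 : ℕ) := by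
  rw [eq_sub_iff_add_eq]
  have := sum_erase_add univ (fun u : Σ a : Fin k, Fin (v a) =>
    min ((t.1.1 + 1 : ℕ) : ℤ) ((u.1.1 + 1 : ℕ) : ℤ)) (mem_univ t)
  simp only [min_self] at this
  rw [this, Fintype.sum_sigma]
  refine sum_congr rfl fun b _ => ?_
  simp [mul_comm]

theorem deg_Dz {k l s : ℕ} (hl : l ≤ k) {m v : Fin k → ℕ} {f : MvPolynomial (Fin s) ℂ}
    (hf : f ∈ Good k l s m) (p : Fin s → Σ a : Fin k, Fin (v a))
    (hp : ∀ t, fib p t = t.1.1 + 1)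
    (hne : rename p f ≠ 0) (h : MvPolynomial (Σ a : Fin k, Fin (v a)) ℂ)
    (hh : rename p f = QA (fib p) * QB (k - l) (fib p) * h) (t : Σ a : Fin k, Fin (v a)) :
    (degreeOf t h : ℤ) ≤ Dz k l m v (t.1.1 + 1) := by
  classical
  have h1 := quot_bound hf p hne h hh t (by rw [hp]; omega)
  simp only [hp] at h1
  rw [min_sum] at h1
  unfold Dz
  have h2 : ∑ b : Fin k, min ((t.1.1 + 1 : ℕ) : ℤ) ((b.1 : ℤ) + 1) * ((m b : ℤ) - 2 * (v b : ℤ))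
      = (Ma k m (t.1.1 + 1) : ℤ) -
        2 * ∑ b : Fin k, min ((t.1.1 + 1 : ℕ) : ℤ) ((b.1 : ℤ) + 1) * v b := by
    unfold Ma
    push_cast
    rw [mul_sum, ← sum_sub_distrib]
    refine sum_congr rfl fun b _ => ?_
    ring
  rw [h2]
  have h3 : ((t.1.1 + 1 - (k - l) : ℕ) : ℤ) =
      max (((t.1.1 + 1 : ℕ) : ℤ) - (k : ℤ) + (l : ℤ)) 0 := by omega
  rw [h3] at h1
  linarith

theorem dimE {k l s : ℕ} (hl : l ≤ k) {m v : Fin k → ℕ} (hs : wt k m = 2 * s + l)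
    (hv : ∑ a : Fin k, (a.1 + 1) * v a = s)
    (p : Fin s → Σ a : Fin k, Fin (v a)) (hp : ∀ t, fib p t = t.1.1 + 1)
    (G : Submodule ℂ (MvPolynomial (Fin s) ℂ)) (hG : G ≤ Good k l s m)
    (H : ∀ f ∈ G, ∀ q : Fin s → (Σ a : Fin k, Fin (v a)) ⊕ Fin s, W p < W q → rename q f = 0) :
    FiniteDimensional ℂ (G.map (rename p : MvPolynomial (Fin s) ℂ →ₐ[ℂ] _).toLinearMap) ∧
    Module.finrank ℂ (G.map (rename p : MvPolynomial (Fin s) ℂ →ₐ[ℂ] _).toLinearMap) ≤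
      ∏ a, czChoose (Pent k l m v a) (v a) := by
  classical
  by_cases hz : ∀ f ∈ G, rename p f = 0
  · have : G.map (rename p : MvPolynomial (Fin s) ℂ →ₐ[ℂ] _).toLinearMap = ⊥ := by
      rw [eq_bot_iff]
      rintro _ ⟨f, hf, rfl⟩
      exact hz f hf
    rw [this]
    exact ⟨inferInstance, by simp⟩
  push Not at hz
  obtain ⟨f0, hf0, hne0⟩ := hz
  obtain ⟨g0, hg0⟩ := QAB_dvd (hG hf0) p (H f0 hf0)
  have hDz : ∀ a ≤ k, 0 ≤ Dz k l m v a := by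
    apply Dz_nonneg hl hs hv
    intro a ha
    have := deg_Dz hl (hG hf0) p hp hne0 g0 hg0 ⟨a, ⟨0, ha⟩⟩
    exact le_trans (by positivity) this
  let D : Fin k → ℕ := fun a => (Dz k l m v (a.1 + 1)).toNat
  have hD : ∀ a : Fin k, (D a : ℤ) = Dz k l m v (a.1 + 1) := fun a =>
    Int.toNat_of_nonneg (hDz _ a.isLt)
  have hprod : ∏ a, czChoose (Pent k l m v a) (v a) = ∏ a, (D a + v a).choose (v a) := by
    refine prod_congr rfl fun a _ => ?_
    have e : Pent k l m v a = ((D a + v a : ℕ) : ℤ) := by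
      rw [Pent_eq, Nat.cast_add, hD]
    rw [e]
    unfold czChoose
    rw [if_pos (by positivity), Int.toNat_natCast]
  rw [hprod]
  obtain ⟨i1, i2⟩ := Hsp_finrank v D
  have hle : G.map (rename p : MvPolynomial (Fin s) ℂ →ₐ[ℂ] _).toLinearMap ≤
      (Hsp v D).map (LinearMap.mulLeft ℂ (QA (fib p) * QB (k - l) (fib p))) := by
    rintro _ ⟨f, hf, rfl⟩
    obtain ⟨h, hh⟩ := QAB_dvd (hG hf) p (H f hf)
    refine ⟨h, ⟨?_, ?_⟩, hh.symm⟩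
    · intro τ
      have hτ : ∀ t, fib p (Equiv.sigmaCongrRight τ t) = fib p t := by
        intro t; rw [hp, hp]; rfl
      obtain ⟨σ, hσ⟩ := exists_perm (Equiv.sigmaCongrRight τ ∘ p) p (by
        intro t
        obtain ⟨t, rfl⟩ := (Equiv.sigmaCongrRight τ).surjective t
        rw [fib_comp_inj p _ (Equiv.injective _), hτ])
      have e1 : rename (Equiv.sigmaCongrRight τ) (rename p f) = rename p f := by
        rw [rename_rename]
        have : (Equiv.sigmaCongrRight τ ∘ p) = p ∘ σ := by funext i; exact (hσ i).symm
        rw [this, ← rename_rename, (hG hf).1 σ]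
      rw [hh, map_mul, map_mul, QA_inv _ _ hτ, QB_inv _ _ _ hτ] at e1
      exact mul_left_cancel₀ (mul_ne_zero (QA_ne _) (QB_ne _ _)) e1
    · rintro e ⟨t, ht⟩
      by_cases hne : rename p f = 0
      · rw [hne] at hh
        have : h = 0 := by
          rcases mul_eq_zero.1 hh.symm with h0 | h0
          · exact absurd h0 (mul_ne_zero (QA_ne _) (QB_ne _ _))
          · exact h0
        rw [this, coeff_zero]
      · have h1 := deg_Dz hl (hG hf) p hp hne h hh t
        rw [← hD] at h1
        by_contra hc
        have h2 := degreeOf_le_iff.1 (le_refl (degreeOf t h)) e (mem_support_iff.2 hc)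
        omega
  have i3 : FiniteDimensional ℂ ((Hsp v D).map
    (LinearMap.mulLeft ℂ (QA (fib p) * QB (k - l) (fib p)))) := inferInstance
  exact ⟨Submodule.finiteDimensional_of_le hle,
    (Submodule.finrank_mono hle).trans ((Submodule.finrank_map_le _ _).trans i2)⟩

end FB
/- STATEMENT 15: `𝓕` is finite dimensional and
`dim 𝓕 ≤ ∑_{𝐬 : 2|𝐬| = |m| - l} ∏_a C(P_a(𝐬), s_a)` (the fermionic bound). -/
theorem statement15 (k l s : ℕ) (hk : 1 ≤ k) (hl : l ≤ k)
    (m : Fin k → ℕ) (hs : wt k m = 2 * s + l) :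
    FiniteDimensional ℂ (Submodule.span ℂ (FSpace k l s m)) ∧
    Module.finrank ℂ (Submodule.span ℂ (FSpace k l s m)) ≤
      ∑ v : Fin k → Fin (s + 1),
        if 2 * (∑ a : Fin k, (a.1 + 1) * (v a : ℕ)) + l = wt k m then
          ∏ a : Fin k, czChoose (Pent k l m (fun b => (v b : ℕ)) a) (v a : ℕ)
        else 0 := by
  classical
  have hval : ∀ v : {v : Fin k → Fin (s + 1) //
      2 * (∑ a : Fin k, (a.1 + 1) * (v a : ℕ)) + l = wt k m},
      ∑ a : Fin k, (a.1 + 1) * (v.1 a : ℕ) = s := by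
    intro v
    have := v.2
    omega
  choose pp hpp using fun v => FB.chooseP (fun a => (v.1 a : ℕ)) (hval v)
  have key : ∀ f ∈ FB.Good k l s m, ∀ (T : Type) [Fintype T] (q : Fin s → T),
      (∀ t, FB.fib q t ≤ k) →
      ∃ v, FB.W (pp v) = FB.W q ∧
        (MvPolynomial.rename (pp v) f = 0 → MvPolynomial.rename q f = 0) := by
    intro f hf T _ q hq
    obtain ⟨v, hv, hvp⟩ := FB.typ q hq
    have hvs : ∀ a, v a < s + 1 := by
      intro a
      have h1 := Finset.single_le_sum (f := fun a : Fin k => (a.1 + 1) * v a)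
        (fun i _ => Nat.zero_le _) (Finset.mem_univ a)
      rw [hv] at h1
      nlinarith
    let v' : {v : Fin k → Fin (s + 1) //
      2 * (∑ a : Fin k, (a.1 + 1) * (v a : ℕ)) + l = wt k m} :=
      ⟨fun a => ⟨v a, hvs a⟩, by simp only; rw [hv]; exact hs.symm⟩
    obtain ⟨ψ, hψ, σ, hσ⟩ := hvp (pp v') (hpp v')
    refine ⟨v', ?_, ?_⟩
    · have : q = (ψ ∘ pp v') ∘ σ := by funext i; exact (hσ i).symm
      rw [this, FB.W_comp_perm, FB.W_comp_inj _ _ hψ]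
    · intro h0
      rw [FB.rename_typ hf.1 (pp v') q ψ σ hσ, h0, map_zero]
  have main := FB.filt (V := MvPolynomial (Fin s) ℂ)
    (fun v : {v : Fin k → Fin (s + 1) //
      2 * (∑ a : Fin k, (a.1 + 1) * (v a : ℕ)) + l = wt k m} =>
      MvPolynomial (Σ a : Fin k, Fin (v.1 a : ℕ)) ℂ)
    (fun v => (MvPolynomial.rename (pp v) : MvPolynomial (Fin s) ℂ →ₐ[ℂ] _).toLinearMap)
    (fun v => FB.W (pp v))
    (fun v => ∏ a : Fin k, czChoose (Pent k l m (fun b => (v.1 b : ℕ)) a) (v.1 a : ℕ))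
    Finset.univ (Submodule.span ℂ (FSpace k l s m)) (by
      intro f hf h0
      obtain ⟨v, _, hv⟩ := key f (FB.FSpace_le k l s m hf) (Fin s) id (by
        intro t
        rw [FB.fib_eq]
        simpa [Finset.filter_eq'] using hk)
      have := hv (h0 v (Finset.mem_univ _))
      rwa [MvPolynomial.rename_id_apply] at this) (by
      intro v _ G' hG' hH
      have hG : G' ≤ FB.Good k l s m := hG'.trans (FB.FSpace_le k l s m)
      refine FB.dimE hl hs (hval v) (pp v) (hpp v) G' hG ?_
      intro f hf q hq
      by_cases hbig : ∃ t, k < FB.fib q t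
      · exact FB.big_zero hl hs (hG hf) _ _ q (Nat.lt_succ_self _) hbig
      · push Not at hbig
        obtain ⟨v', hw, hv'⟩ := key f (hG hf) _ q hbig
        exact hv' (hH f hf v' (Finset.mem_univ _) (by rw [hw]; exact hq)))
  refine ⟨main.1, main.2.trans (le_of_eq ?_)⟩
  rw [← Finset.sum_filter]
  exact (Finset.sum_subtype _ (by simp) (fun v : Fin k → Fin (s + 1) =>
    ∏ a : Fin k, czChoose (Pent k l m (fun b => (v b : ℕ)) a) (v a : ℕ))).symm
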